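/- Let A be a POVM on (Ω_A, ℬ_A) over a separable Hilbert space, T : Ω_A → Ω_T a measurable statistic, and A_T the pushforward POVM. Then T is a sufficient statistic for the statistical model {P^A_ρ} if and only if A ≃_w A_T (A and A_T are weakly fuzzy equivalent). -/

import Mathlib

open MeasureTheory
open scoped InnerProductSpace ENNReal

/-- A positive-operator valued measure on outcome space `Ω` over the Hilbert space `H`.
σ-additivity in the weak operator topology is encoded by the family of scalar measures
`E ↦ ⟪x, A(E) x⟫` attached to each vector `x`. -/
structure POVM (Ω : Type*) [MeasurableSpace Ω] (H : Type*) [NormedAddCommGroup H]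
    [InnerProductSpace ℂ H] [CompleteSpace H] where
  toFun : Set Ω → H →L[ℂ] H
  pos : ∀ E, MeasurableSet E → (toFun E).IsPositive
  map_univ : toFun Set.univ = 1
  measure : H → MeasureTheory.Measure Ω
  measure_apply : ∀ (x : H) (E : Set Ω), MeasurableSet E →
    measure x E = ENNReal.ofReal (⟪x, toFun E x⟫_ℂ).re

variable {H : Type*} [NormedAddCommGroup H] [InnerProductSpace ℂ H] [CompleteSpace H]

/-- A state (positive trace-class operator of unit trace), with trace computed
in the Hilbert basis `b` of the separable Hilbert space `H`. -/
structure QState (b : HilbertBasis ℕ ℂ H) where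
  op : H →L[ℂ] H
  pos : op.IsPositive
  tr_one : HasSum (fun i => (⟪b i, op (b i)⟫_ℂ).re) 1

/-- The trace of an operator `T`, computed in the Hilbert basis `b`. -/
noncomputable def trOp (b : HilbertBasis ℕ ℂ H) (T : H →L[ℂ] H) : ℝ :=
  ∑' i, (⟪b i, T (b i)⟫_ℂ).re

/-- A property holds `A`-almost everywhere if it holds outside an `A`-null measurable set. -/
def POVM.ae {Ω : Type*} [MeasurableSpace Ω] (A : POVM Ω H) (p : Ω → Prop) : Prop :=
  ∃ N, MeasurableSet N ∧ A.toFun N = 0 ∧ ∀ y ∉ N, p y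

/-- A `B`-weak Markov kernel: measurable in the second argument, and satisfying the
probability measure axioms `B`-almost everywhere. -/
structure IsWeakMarkovKernel {Ω₁ Ω₂ : Type*} [MeasurableSpace Ω₁] [MeasurableSpace Ω₂]
    (B : POVM Ω₂ H) (κ : Set Ω₁ → Ω₂ → ℝ) : Prop where
  meas : ∀ E, MeasurableSet E → Measurable (κ E)
  bdd : ∀ E, MeasurableSet E → B.ae (fun y => 0 ≤ κ E y ∧ κ E y ≤ 1)
  univ : B.ae fun y => κ Set.univ y = 1
  empty : B.ae fun y => κ ∅ y = 0
  additive : ∀ E : ℕ → Set Ω₁, (∀ n, MeasurableSet (E n)) →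
    Pairwise (Function.onFun Disjoint E) →
    B.ae fun y => HasSum (fun n => κ (E n) y) (κ (⋃ n, E n) y)

/-- `A ⪯_w B`: `A(E) = ∫ κ(E|y) dB(y)` for a `B`-weak Markov kernel `κ`
(the operator equality is expressed weakly, via all vectors `x`). -/
def POVM.WeakFuzzier {Ω₁ Ω₂ : Type*} [MeasurableSpace Ω₁] [MeasurableSpace Ω₂]
    (A : POVM Ω₁ H) (B : POVM Ω₂ H) : Prop :=
  ∃ κ : Set Ω₁ → Ω₂ → ℝ, IsWeakMarkovKernel B κ ∧
    ∀ E, MeasurableSet E → ∀ x : H, (⟪x, A.toFun E x⟫_ℂ).re = ∫ y, κ E y ∂(B.measure x)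

/-- `A ≃_w B`: weak fuzzy equivalence. -/
def POVM.WeakEquiv {Ω₁ Ω₂ : Type*} [MeasurableSpace Ω₁] [MeasurableSpace Ω₂]
    (A : POVM Ω₁ H) (B : POVM Ω₂ H) : Prop :=
  A.WeakFuzzier B ∧ B.WeakFuzzier A

open ContinuousLinearMap

theorem ContinuousLinearMap.IsPositive.exists_isSelfAdjoint_comp_self {S : H →L[ℂ] H}
    (hS : S.IsPositive) : ∃ R : H →L[ℂ] H, IsSelfAdjoint R ∧ R ∘L R = S := by
  have h0 : 0 ≤ S := (nonneg_iff_isPositive S).2 hS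
  exact ⟨CFC.sqrt S, (CFC.sqrt_nonneg S).isSelfAdjoint, CFC.sqrt_mul_sqrt_self S h0⟩

theorem IsSelfAdjoint.inner_apply_left {R : H →L[ℂ] H} (hR : IsSelfAdjoint R) (x y : H) :
    ⟪R x, y⟫_ℂ = ⟪x, R y⟫_ℂ :=
  hR.isSymmetric x y

theorem ContinuousLinearMap.IsPositive.apply_eq_zero_of_re_inner_eq_zero {S : H →L[ℂ] H}
    (hS : S.IsPositive) {x : H} (hx : (⟪x, S x⟫_ℂ).re = 0) : S x = 0 := by
  obtain ⟨R, hR, rfl⟩ := hS.exists_isSelfAdjoint_comp_self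
  have h : ‖R x‖ ^ 2 = 0 := by
    rw [← hx, comp_apply, ← hR.inner_apply_left]
    exact (inner_self_eq_norm_sq (𝕜 := ℂ) (R x)).symm
  rw [comp_apply, norm_eq_zero.1 (pow_eq_zero_iff two_ne_zero |>.1 h), map_zero]

theorem HilbertBasis.hasSum_norm_inner_sq {ι E : Type*} [NormedAddCommGroup E]
    [InnerProductSpace ℂ E] (b : HilbertBasis ι ℂ E) (x : E) :
    HasSum (fun i => ‖⟪x, b i⟫_ℂ‖ ^ 2) (‖x‖ ^ 2) := by
  have h := Complex.reCLM.hasSum (b.hasSum_inner_mul_inner x x)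
  convert h using 1
  · funext i
    refine .trans ?_ (inner_mul_symm_re_eq_norm (𝕜 := ℂ) x (b i)).symm
    rw [norm_mul, norm_inner_symm (b i) x, sq]
  · exact (inner_self_eq_norm_sq (𝕜 := ℂ) x).symm

theorem HilbertBasis.summable_prod_norm_inner_sq {ι κ E : Type*} [NormedAddCommGroup E]
    [InnerProductSpace ℂ E] (b : HilbertBasis ι ℂ E) {u : κ → E}
    (hu : Summable fun j => ‖u j‖ ^ 2) :
    Summable fun p : κ × ι => ‖⟪u p.1, b p.2⟫_ℂ‖ ^ 2 := by
  refine (summable_prod_of_nonneg fun p => by positivity).2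
    ⟨fun j => (b.hasSum_norm_inner_sq (u j)).summable, hu.congr fun j => ?_⟩
  exact (b.hasSum_norm_inner_sq (u j)).tsum_eq.symm

theorem HilbertBasis.summable_prod_inner_mul_inner {ι κ E : Type*} [NormedAddCommGroup E]
    [InnerProductSpace ℂ E] (b : HilbertBasis ι ℂ E) {u v : κ → E}
    (hu : Summable fun j => ‖u j‖ ^ 2) (hv : Summable fun j => ‖v j‖ ^ 2) :
    Summable fun p : κ × ι => ⟪u p.1, b p.2⟫_ℂ * ⟪b p.2, v p.1⟫_ℂ := by
  refine .of_norm_bounded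
    ((b.summable_prod_norm_inner_sq hu).add (b.summable_prod_norm_inner_sq hv)) fun p => ?_
  rw [norm_mul, norm_inner_symm (b p.2)]
  nlinarith [sq_nonneg (‖⟪u p.1, b p.2⟫_ℂ‖ - ‖⟪v p.1, b p.2⟫_ℂ‖),
    sq_nonneg ‖⟪u p.1, b p.2⟫_ℂ‖, sq_nonneg ‖⟪v p.1, b p.2⟫_ℂ‖]

theorem QState.exists_hasSum_inner {b : HilbertBasis ℕ ℂ H} (ρ : QState b) :
    ∃ y : ℕ → H, ∀ S : H →L[ℂ] H,
      HasSum (fun j => (⟪y j, S (y j)⟫_ℂ).re) (trOp b (ρ.op ∘L S)) := by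
  obtain ⟨R, hR, hRρ⟩ := ρ.pos.exists_isSelfAdjoint_comp_self
  refine ⟨fun j => R (b j), fun S => ?_⟩
  have hv : Summable fun j => ‖R (b j)‖ ^ 2 := by
    refine ρ.tr_one.summable.congr fun j => ?_
    rw [← hRρ, comp_apply, ← hR.inner_apply_left]
    exact (inner_self_eq_norm_sq (𝕜 := ℂ) (R (b j)))
  have hu : Summable fun j => ‖adjoint S (R (b j))‖ ^ 2 := by
    refine .of_nonneg_of_le (fun _ => by positivity) (fun j => ?_)
      (hv.mul_left (‖adjoint S‖ ^ 2))
    rw [← mul_pow]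
    gcongr
    exact le_opNorm _ _
  obtain ⟨s, hs⟩ := b.summable_prod_inner_mul_inner hu hv
  have hrow : HasSum (fun j => ⟪R (b j), S (R (b j))⟫_ℂ) s :=
    hs.prod_fiberwise fun j => by
      rw [← adjoint_inner_left S (R (b j)) (R (b j))]
      exact b.hasSum_inner_mul_inner (adjoint S (R (b j))) (R (b j))
  have hcol : HasSum (fun i => ⟪b i, (ρ.op ∘L S) (b i)⟫_ℂ) s := by
    refine ((Equiv.prodComm ℕ ℕ).hasSum_iff.2 hs).prod_fiberwise fun i => ?_
    rw [← hRρ, comp_apply, comp_apply, ← hR.inner_apply_left (b i) (R (S (b i)))]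
    refine Eq.subst (motive := fun f : ℕ → ℂ => HasSum f _) (funext fun j => ?_)
      (b.hasSum_inner_mul_inner (R (b i)) (R (S (b i))))
    change _ = ⟪adjoint S (R (b j)), b i⟫_ℂ * ⟪b i, R (b j)⟫_ℂ
    rw [adjoint_inner_left S (b i) (R (b j)), hR.inner_apply_left (b j) (S (b i)),
      ← hR.inner_apply_left (b i) (b j), mul_comm]
  have htr : trOp b (ρ.op ∘L S) = s.re := (Complex.reCLM.hasSum hcol).tsum_eq
  rw [htr]
  exact Complex.reCLM.hasSum hrow

/-- The pure state given by a unit vector. -/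
noncomputable def QState.pure (b : HilbertBasis ℕ ℂ H) (x : H) (hx : ‖x‖ = 1) : QState b where
  op := InnerProductSpace.rankOne ℂ x x
  pos := InnerProductSpace.isPositive_rankOne_self x
  tr_one := by
    convert Complex.reCLM.hasSum (b.hasSum_inner_mul_inner x x) using 1
    · funext i
      simp
    · simp [hx]

theorem QState.trOp_pure_comp (b : HilbertBasis ℕ ℂ H) {x : H} (hx : ‖x‖ = 1)
    (S : H →L[ℂ] H) : trOp b ((QState.pure b x hx).op ∘L S) = (⟪x, S x⟫_ℂ).re := by
  rw [← adjoint_inner_left, ← Complex.reCLM_apply,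
    ← (Complex.reCLM.hasSum (b.hasSum_inner_mul_inner (adjoint S x) x)).tsum_eq]
  simp [trOp, QState.pure, adjoint_inner_left]

section Measure

variable {Ω Ω' : Type*} [MeasurableSpace Ω] [MeasurableSpace Ω']

theorem MeasureTheory.Measure.integral_toReal_rnDeriv_map_comp_mul {μ ν : Measure Ω}
    [IsFiniteMeasure μ] [IsFiniteMeasure ν] (hνμ : ν ≪ μ) {T : Ω → Ω'} (hT : Measurable T)
    {f : Ω' → ℝ} (hf : Measurable f) :
    ∫ ω, f (T ω) * ((ν.map T).rnDeriv (μ.map T) (T ω)).toReal ∂μ = ∫ ω, f (T ω) ∂ν := by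
  have h := integral_rnDeriv_smul (f := f) (hνμ.map hT)
  rw [integral_map hT.aemeasurable hf.aestronglyMeasurable,
    integral_map hT.aemeasurable (by fun_prop)] at h
  simpa only [smul_eq_mul, mul_comm] using h

theorem MeasureTheory.Measure.integrable_toReal_rnDeriv_map_comp (μ ν : Measure Ω)
    [IsFiniteMeasure ν] {T : Ω → Ω'} (hT : Measurable T) :
    Integrable (fun ω => ((ν.map T).rnDeriv (μ.map T) (T ω)).toReal) μ :=
  Measure.integrable_toReal_rnDeriv.comp_measurable hT

/-- If every event can be replaced by a randomized test depending only on `T`, with the same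
`μ`- and `ν`-probability, then the density of `ν` with respect to `μ` is a function of `T`. -/
theorem MeasureTheory.Measure.eq_withDensity_rnDeriv_map_comp {μ ν : Measure Ω}
    [IsFiniteMeasure μ] [IsFiniteMeasure ν] (hνμ : ν ≪ μ) {T : Ω → Ω'} (hT : Measurable T)
    (htest : ∀ E, MeasurableSet E → ∃ f : Ω' → ℝ, Measurable f ∧
      (∀ᵐ ω ∂μ, 0 ≤ f (T ω) ∧ f (T ω) ≤ 1) ∧
      μ.real E = ∫ ω, f (T ω) ∂μ ∧ ν.real E = ∫ ω, f (T ω) ∂ν) :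
    ν = μ.withDensity (fun ω => (ν.map T).rnDeriv (μ.map T) (T ω)) := by
  set g : Ω → ℝ := fun ω => (ν.rnDeriv μ ω).toReal
  set k : Ω' → ℝ := fun t => ((ν.map T).rnDeriv (μ.map T) t).toReal
  have hgm : Measurable g := by fun_prop
  have hkm : Measurable k := by fun_prop
  have hgi : Integrable g μ := Measure.integrable_toReal_rnDeriv
  have hki : Integrable (fun ω => k (T ω)) μ := integrable_toReal_rnDeriv_map_comp μ ν hT
  have hthreshold (c : ℚ) : ∀ᵐ ω ∂μ, (c : ℝ) < g ω → (c : ℝ) < k (T ω) := by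
    set E := {ω | (c : ℝ) < g ω}
    set D := {ω | (c : ℝ) < k (T ω)}
    have hEm : MeasurableSet E := measurableSet_lt measurable_const hgm
    have hDm : MeasurableSet D := measurableSet_lt measurable_const (hkm.comp hT)
    obtain ⟨f, hfm, hf01, hfμ, hfν⟩ := htest E hEm
    have hfi : Integrable (fun ω => f (T ω)) μ :=
      .of_bound (hfm.comp hT).aestronglyMeasurable 1 (hf01.mono fun ω h => by
        rw [Real.norm_of_nonneg h.1]; exact h.2)
    have hfki : Integrable (fun ω => f (T ω) * k (T ω)) μ :=
      hki.bdd_mul (hfm.comp hT).aestronglyMeasurable (c := 1) (hf01.mono fun ω h => by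
        rw [Real.norm_of_nonneg h.1]; exact h.2)
    have hgci : Integrable (fun ω => g ω - c) μ := hgi.sub (integrable_const _)
    have hkci : Integrable (fun ω => k (T ω) - c) μ := hki.sub (integrable_const _)
    have hgset (s : Set Ω) : ∫ ω in s, (g ω - c) ∂μ = ν.real s - μ.real s * c := by
      rw [integral_sub hgi.integrableOn (integrable_const _),
        Measure.setIntegral_toReal_rnDeriv hνμ]
      simp
    have hkD : ∫ ω in D, (k (T ω) - c) ∂μ = ν.real D - μ.real D * c := by
      rw [integral_sub hki.integrableOn (integrable_const _)]
      have hFm : MeasurableSet {t | (c : ℝ) < k t} := measurableSet_lt measurable_const hkm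
      have := Measure.setIntegral_toReal_rnDeriv (hνμ.map hT) {t | (c : ℝ) < k t}
      rw [setIntegral_map hFm hkm.aestronglyMeasurable hT.aemeasurable,
        map_measureReal_apply hT hFm] at this
      simp only [setIntegral_const, smul_eq_mul]
      congr 1
    have hle : ∫ ω, E.indicator (fun ω => g ω - c) ω ∂μ
        ≤ ∫ ω, D.indicator (fun ω => g ω - c) ω ∂μ := by
      rw [integral_indicator hEm, integral_indicator hDm, hgset, hgset, ← hkD, hfμ, hfν,
        ← integral_toReal_rnDeriv_map_comp_mul hνμ hT hfm, ← integral_mul_const,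
        ← integral_sub hfki (hfi.mul_const _), ← integral_indicator hDm]
      refine integral_mono_ae (hfki.sub (hfi.mul_const _)) (hkci.indicator hDm) ?_
      filter_upwards [hf01] with ω hω
      by_cases hωD : ω ∈ D
      · rw [Set.indicator_of_mem hωD]
        have : (c : ℝ) < k (T ω) := hωD
        change f (T ω) * k (T ω) - f (T ω) * c ≤ _
        nlinarith [hω.2]
      · rw [Set.indicator_of_notMem hωD]
        have : k (T ω) ≤ c := not_lt.1 hωD
        change f (T ω) * k (T ω) - f (T ω) * c ≤ _
        nlinarith [hω.1]
    have hpt (ω : Ω) : D.indicator (fun ω => g ω - c) ω ≤ E.indicator (fun ω => g ω - c) ω := by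
      by_cases hωE : ω ∈ E
      · have : (c : ℝ) < g ω := hωE
        rw [Set.indicator_of_mem hωE]
        exact Set.indicator_apply_le' (fun _ => le_rfl) fun _ => by linarith
      · have : g ω ≤ c := not_lt.1 hωE
        rw [Set.indicator_of_notMem hωE]
        exact Set.indicator_apply_le' (fun _ => by linarith) fun _ => le_rfl
    have hint : ∫ ω, D.indicator (fun ω => g ω - c) ω ∂μ
        = ∫ ω, E.indicator (fun ω => g ω - c) ω ∂μ :=
      le_antisymm (integral_mono (hgci.indicator hDm) (hgci.indicator hEm) hpt) hle
    filter_upwards [(integral_eq_iff_of_ae_le (hgci.indicator hDm) (hgci.indicator hEm)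
      (.of_forall hpt)).1 hint] with ω hω hωE
    by_contra hωD
    rw [Set.indicator_of_notMem (s := D) hωD, Set.indicator_of_mem (s := E) hωE] at hω
    linarith
  have hgk : g ≤ᵐ[μ] fun ω => k (T ω) := by
    filter_upwards [ae_all_iff.2 hthreshold] with ω hω
    by_contra! hlt
    obtain ⟨c, hc₁, hc₂⟩ := exists_rat_btwn hlt
    exact (hω c hc₂).not_gt hc₁
  have heq : g =ᵐ[μ] fun ω => k (T ω) := by
    refine (integral_eq_iff_of_ae_le hgi hki hgk).1 ?_
    have h₁ := Measure.integral_toReal_rnDeriv hνμ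
    have h₂ := integral_toReal_rnDeriv_map_comp_mul hνμ hT (f := fun _ => 1) measurable_const
    simp only [one_mul, integral_const, smul_eq_mul, mul_one] at h₂
    exact h₁.trans h₂.symm
  conv_lhs => rw [← Measure.withDensity_rnDeriv_eq ν μ hνμ]
  refine withDensity_congr_ae ?_
  have hfin : ∀ᵐ ω ∂μ, (ν.map T).rnDeriv (μ.map T) (T ω) < ∞ :=
    ae_of_ae_map hT.aemeasurable (Measure.rnDeriv_lt_top _ _)
  filter_upwards [heq, hfin, Measure.rnDeriv_lt_top ν μ] with ω h h₁ h₂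
  exact (ENNReal.toReal_eq_toReal_iff' h₂.ne h₁.ne).1 h

/-- A density depending only on `T` does not change conditional probabilities given `T`. -/
theorem MeasureTheory.Measure.setLIntegral_rnDeriv_map_restrict_of_withDensity_comp
    {μ : Measure Ω} [IsFiniteMeasure μ] {T : Ω → Ω'} (hT : Measurable T) {h : Ω' → ℝ≥0∞}
    (hh : Measurable h) {E : Set Ω} (hE : MeasurableSet E) {F : Set Ω'} (hF : MeasurableSet F) :
    ∫⁻ t in F, ((μ.restrict E).map T).rnDeriv (μ.map T) t
      ∂((μ.withDensity fun ω => h (T ω)).map T) =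
      (μ.withDensity fun ω => h (T ω)) (E ∩ T ⁻¹' F) := by
  have hac : (μ.restrict E).map T ≪ μ.map T := Measure.absolutelyContinuous_restrict.map hT
  have hmap : (μ.withDensity fun ω => h (T ω)).map T = (μ.map T).withDensity h := by
    ext s hs
    rw [Measure.map_apply hT hs, withDensity_apply _ (hT hs), withDensity_apply _ hs,
      setLIntegral_map hs hh hT]
  rw [hmap, setLIntegral_withDensity_eq_setLIntegral_mul _ hh (Measure.measurable_rnDeriv _ _) hF,
    withDensity_apply _ (hE.inter (hT hF)), Set.inter_comm,
    ← Measure.restrict_restrict (hT hF), ← setLIntegral_map hF hh hT,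
    ← lintegral_indicator hF, ← lintegral_indicator hF,
    ← lintegral_rnDeriv_mul hac (hh.indicator hF).aemeasurable]
  congr 1 with t
  by_cases ht : t ∈ F <;> simp [ht, mul_comm]

theorem MeasureTheory.ae_le_one_of_setIntegral_eq {μ : Measure Ω} [IsFiniteMeasure μ]
    {T : Ω → Ω'} (hT : Measurable T) {E : Set Ω} {q : Ω' → ℝ} (hq : Measurable q)
    (hq0 : ∀ t, 0 ≤ q t)
    (hqE : ∀ F, MeasurableSet F → μ.real (E ∩ T ⁻¹' F) = ∫ t in F, q t ∂(μ.map T)) :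
    ∀ᵐ t ∂(μ.map T), q t ≤ 1 := by
  have hn (n : ℕ) : ∀ᵐ t ∂(μ.map T), q t ≤ n → q t ≤ 1 := by
    have hG : MeasurableSet {t | q t ≤ n} := measurableSet_le hq measurable_const
    refine (ae_restrict_iff' hG).1 (ae_le_of_forall_setIntegral_le ?_ (integrable_const _) ?_)
    · exact .of_bound hq.aestronglyMeasurable n ((ae_restrict_iff' hG).2 (.of_forall fun t ht => by
        rwa [Real.norm_of_nonneg (hq0 t)]))
    · intro s hs _
      rw [Measure.restrict_restrict hs, ← hqE _ (hs.inter hG)]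
      simp only [setIntegral_const, smul_eq_mul, mul_one]
      rw [map_measureReal_apply hT (hs.inter hG)]
      exact measureReal_mono Set.inter_subset_right
  filter_upwards [ae_all_iff.2 hn] with t ht
  obtain ⟨n, hn⟩ := exists_nat_ge (q t)
  exact ht n hn

theorem MeasureTheory.setLIntegral_ofReal_of_setIntegral_eq {μ : Measure Ω} [IsFiniteMeasure μ]
    {T : Ω → Ω'} (hT : Measurable T) {E : Set Ω} {q : Ω' → ℝ} (hq : Measurable q)
    (hq0 : ∀ t, 0 ≤ q t)
    (hqE : ∀ F, MeasurableSet F → μ.real (E ∩ T ⁻¹' F) = ∫ t in F, q t ∂(μ.map T))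
    {F : Set Ω'} (hF : MeasurableSet F) :
    ∫⁻ t in F, ENNReal.ofReal (q t) ∂(μ.map T) = μ (E ∩ T ⁻¹' F) := by
  have hi : Integrable q ((μ.map T).restrict F) :=
    .of_bound hq.aestronglyMeasurable 1 (ae_restrict_of_ae
      ((ae_le_one_of_setIntegral_eq hT hq hq0 hqE).mono fun t ht => by
        rwa [Real.norm_of_nonneg (hq0 t)]))
  rw [← ofReal_integral_eq_lintegral_ofReal hi (.of_forall hq0), ← hqE F hF, ofReal_measureReal]

end Measure

namespace POVM

variable {Ω Ω' : Type*} [MeasurableSpace Ω] [MeasurableSpace Ω']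

theorem re_inner_nonneg (A : POVM Ω H) (x : H) {E : Set Ω} (hE : MeasurableSet E) :
    0 ≤ (⟪x, A.toFun E x⟫_ℂ).re :=
  (A.pos E hE).re_inner_nonneg_right x

instance (A : POVM Ω H) (x : H) : IsFiniteMeasure (A.measure x) :=
  ⟨by rw [A.measure_apply x _ .univ]; exact ENNReal.ofReal_lt_top⟩

theorem measureReal_apply (A : POVM Ω H) (x : H) {E : Set Ω} (hE : MeasurableSet E) :
    (A.measure x).real E = (⟪x, A.toFun E x⟫_ℂ).re := by
  rw [measureReal_def, A.measure_apply x E hE, ENNReal.toReal_ofReal (A.re_inner_nonneg x hE)]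

theorem measure_univ (A : POVM Ω H) (x : H) : A.measure x Set.univ = ENNReal.ofReal (‖x‖ ^ 2) := by
  rw [A.measure_apply x _ .univ, A.map_univ]
  exact congrArg _ (inner_self_eq_norm_sq (𝕜 := ℂ) x)

theorem measure_smul (A : POVM Ω H) (c : ℝ) (x : H) :
    A.measure ((c : ℂ) • x) = ENNReal.ofReal (c ^ 2) • A.measure x := by
  ext E hE
  rw [Measure.smul_apply, smul_eq_mul, A.measure_apply _ E hE, A.measure_apply _ E hE,
    ← ENNReal.ofReal_mul (sq_nonneg c), map_smul, inner_smul_left, inner_smul_right]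
  simp [sq, mul_assoc]

theorem measure_eq_zero_of_toFun_eq_zero (A : POVM Ω H) {N : Set Ω} (hN : MeasurableSet N)
    (h : A.toFun N = 0) (x : H) : A.measure x N = 0 := by
  simp [A.measure_apply x N hN, h]

theorem toFun_eq_zero_of_forall_measure_eq_zero (A : POVM Ω H) {ι : Type*}
    (b : HilbertBasis ι ℂ H) {N : Set Ω} (hN : MeasurableSet N)
    (h : ∀ i, A.measure (b i) N = 0) : A.toFun N = 0 := by
  refine ContinuousLinearMap.ext_on
    (Submodule.dense_iff_topologicalClosure_eq_top.2 b.dense_span) ?_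
  rintro _ ⟨i, rfl⟩
  refine (A.pos N hN).apply_eq_zero_of_re_inner_eq_zero ?_
  rw [← A.measureReal_apply (b i) hN, measureReal_def, h i, ENNReal.toReal_zero]

theorem ae.ae_measure {A : POVM Ω H} {p : Ω → Prop} (h : A.ae p) (x : H) :
    ∀ᵐ ω ∂(A.measure x), p ω := by
  obtain ⟨N, hN, hAN, hp⟩ := h
  exact measure_mono_null (fun ω hω => by_contra fun hωN => hω (hp ω hωN))
    (A.measure_eq_zero_of_toFun_eq_zero hN hAN x)

theorem ae_of_forall_ae_measure {A : POVM Ω H} {ι : Type*} [Countable ι] (b : HilbertBasis ι ℂ H)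
    {p : Ω → Prop} (h : ∀ i, ∀ᵐ ω ∂(A.measure (b i)), p ω) : A.ae p := by
  have hsum : Measure.sum (fun i => A.measure (b i)) {ω | ¬ p ω} = 0 :=
    Measure.ae_sum_iff.2 h
  refine ⟨_, measurableSet_toMeasurable (Measure.sum fun i => A.measure (b i)) {ω | ¬ p ω},
    A.toFun_eq_zero_of_forall_measure_eq_zero b (measurableSet_toMeasurable _ _) fun i => ?_,
    fun ω hω => by_contra fun hp => hω (subset_toMeasurable _ _ hp)⟩
  refine Measure.absolutelyContinuous_of_le (Measure.le_sum (fun i => A.measure (b i)) i) ?_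
  rw [measure_toMeasurable, hsum]

theorem ae_of_forall {A : POVM Ω H} {p : Ω → Prop} (h : ∀ ω, p ω) : A.ae p := by
  refine ⟨∅, .empty, ?_, fun ω _ => h ω⟩
  refine ContinuousLinearMap.ext fun x =>
    (A.pos ∅ .empty).apply_eq_zero_of_re_inner_eq_zero ?_
  rw [← A.measureReal_apply x .empty, measureReal_empty]

theorem map_measure {A : POVM Ω H} {B : POVM Ω' H} {T : Ω → Ω'} (hT : Measurable T)
    (hB : ∀ F, MeasurableSet F → B.toFun F = A.toFun (T ⁻¹' F)) (x : H) :
    (A.measure x).map T = B.measure x := by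
  ext F hF
  rw [Measure.map_apply hT hF, A.measure_apply x _ (hT hF), B.measure_apply x F hF, hB F hF]

theorem _root_.hasSum_indicator_one_iUnion {α ι : Type*} {s : ι → Set α}
    (hs : Pairwise (Function.onFun Disjoint s)) (a : α) :
    HasSum (fun i => (s i).indicator (1 : α → ℝ) a) ((⋃ i, s i).indicator 1 a) := by
  by_cases ha : a ∈ ⋃ i, s i
  · obtain ⟨i, hi⟩ := Set.mem_iUnion.1 ha
    rw [show (⋃ i, s i).indicator (1 : α → ℝ) a = (s i).indicator 1 a by simp [ha, hi]]
    refine hasSum_single i fun j hj => Set.indicator_of_notMem (fun haj => ?_) _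
    exact Set.disjoint_left.1 (hs hj) haj hi
  · rw [Set.indicator_of_notMem ha]
    convert hasSum_zero using 2 with i
    exact Set.indicator_of_notMem (fun hi => ha (Set.mem_iUnion_of_mem i hi)) _

theorem weakFuzzier_of_map {A : POVM Ω H} {B : POVM Ω' H} {T : Ω → Ω'} (hT : Measurable T)
    (hB : ∀ F, MeasurableSet F → B.toFun F = A.toFun (T ⁻¹' F)) : B.WeakFuzzier A := by
  refine ⟨fun F => (T ⁻¹' F).indicator 1, ⟨fun F hF => measurable_one.indicator (hT hF), ?_, ?_,
    ?_, ?_⟩, fun F hF x => ?_⟩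
  · refine fun F _ => ae_of_forall fun ω => ?_
    by_cases h : ω ∈ T ⁻¹' F <;> simp [h]
  · exact ae_of_forall fun ω => by simp
  · exact ae_of_forall fun ω => by simp
  · refine fun F _ hdisj => ae_of_forall fun ω => ?_
    rw [Set.preimage_iUnion]
    exact hasSum_indicator_one_iUnion
      (hdisj.mono fun _ _ h => h.preimage T) ω
  · rw [integral_indicator_one (hT hF), A.measureReal_apply x (hT hF), hB F hF]

/-- A finite measure with the same null sets as the POVM. -/
noncomputable def refMeasure (A : POVM Ω H) (b : HilbertBasis ℕ ℂ H) : Measure Ω :=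
  Measure.sum fun i => (2⁻¹ : ℝ≥0∞) ^ i • A.measure (b i)

instance (A : POVM Ω H) (b : HilbertBasis ℕ ℂ H) : IsFiniteMeasure (A.refMeasure b) := by
  refine ⟨?_⟩
  rw [refMeasure, Measure.sum_apply _ .univ]
  simp [A.measure_univ, b.orthonormal.norm_eq_one, ENNReal.tsum_geometric]

theorem toFun_eq_zero_of_refMeasure_eq_zero (A : POVM Ω H) (b : HilbertBasis ℕ ℂ H) {N : Set Ω}
    (hN : MeasurableSet N) (h : A.refMeasure b N = 0) : A.toFun N = 0 := by
  refine A.toFun_eq_zero_of_forall_measure_eq_zero b hN fun i => ?_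
  rw [refMeasure, Measure.sum_apply _ hN, ENNReal.tsum_eq_zero] at h
  simpa using h i

theorem ae.ae_refMeasure {A : POVM Ω H} {p : Ω → Prop} (h : A.ae p) (b : HilbertBasis ℕ ℂ H) :
    ∀ᵐ ω ∂(A.refMeasure b), p ω :=
  Measure.ae_sum_iff.2 fun i => Measure.ae_smul_measure (h.ae_measure (b i)) _

end POVM

namespace POVM

variable {Ω Ω' : Type*} [MeasurableSpace Ω] [MeasurableSpace Ω']

theorem exists_eq_sum_measure {b : HilbertBasis ℕ ℂ H} (A : POVM Ω H) (ρ : QState b)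
    {μ : Measure Ω} [IsFiniteMeasure μ]
    (hμ : ∀ E, MeasurableSet E → μ.real E = trOp b (ρ.op ∘L A.toFun E)) :
    ∃ y : ℕ → H, μ = Measure.sum fun j => A.measure (y j) := by
  obtain ⟨y, hy⟩ := ρ.exists_hasSum_inner
  refine ⟨y, Measure.ext fun E hE => ?_⟩
  have h := hy (A.toFun E)
  rw [← ofReal_measureReal, hμ E hE, ← h.tsum_eq,
    ENNReal.ofReal_tsum_of_nonneg (fun j => A.re_inner_nonneg _ hE) h.summable,
    Measure.sum_apply _ hE]
  exact tsum_congr fun j => (A.measure_apply _ E hE).symm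

theorem eq_measure_of_pure {b : HilbertBasis ℕ ℂ H} (A : POVM Ω H) {x : H} (hx : ‖x‖ = 1)
    {μ : Measure Ω} [IsFiniteMeasure μ]
    (hμ : ∀ E, MeasurableSet E → μ.real E = trOp b ((QState.pure b x hx).op ∘L A.toFun E)) :
    μ = A.measure x := by
  refine Measure.ext fun E hE => ?_
  rw [← ofReal_measureReal, hμ E hE, QState.trOp_pure_comp, A.measure_apply x E hE]

theorem measure_eq_lintegral_of_kernel {A : POVM Ω H} {B : POVM Ω' H} {T : Ω → Ω'}
    (hT : Measurable T) (hB : ∀ F, MeasurableSet F → B.toFun F = A.toFun (T ⁻¹' F))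
    {κ : Set Ω → Ω' → ℝ} (hκ : IsWeakMarkovKernel B κ)
    (hAκ : ∀ E, MeasurableSet E → ∀ x : H,
      (⟪x, A.toFun E x⟫_ℂ).re = ∫ y, κ E y ∂(B.measure x))
    {E : Set Ω} (hE : MeasurableSet E) (x : H) :
    A.measure x E = ∫⁻ ω, ENNReal.ofReal (κ E (T ω)) ∂(A.measure x) := by
  have hbd := (hκ.bdd E hE).ae_measure x
  have hi : Integrable (κ E) (B.measure x) :=
    .of_bound (hκ.meas E hE).aestronglyMeasurable 1 (hbd.mono fun t ht => by
      rw [Real.norm_of_nonneg ht.1]; exact ht.2)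
  rw [A.measure_apply x E hE, hAκ E hE x,
    ofReal_integral_eq_lintegral_ofReal hi (hbd.mono fun t ht => ht.1), ← map_measure hT hB x,
    lintegral_map (hκ.meas E hE).ennreal_ofReal hT]

theorem ae_comp_of_ae_map {A : POVM Ω H} {B : POVM Ω' H} {T : Ω → Ω'}
    (hT : Measurable T) (hB : ∀ F, MeasurableSet F → B.toFun F = A.toFun (T ⁻¹' F))
    {p : Ω' → Prop} (h : B.ae p) : A.ae fun ω => p (T ω) := by
  obtain ⟨N, hN, hBN, hp⟩ := h
  exact ⟨T ⁻¹' N, hT hN, by rw [← hB N hN, hBN], fun ω hω => hp _ hω⟩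

/-- A weak Markov kernel which recovers `A` from the image of `A` under a statistic makes that
statistic sufficient. -/
theorem WeakFuzzier.exists_conditional_probability {b : HilbertBasis ℕ ℂ H} {A : POVM Ω H}
    {B : POVM Ω' H} {T : Ω → Ω'} (hT : Measurable T)
    (hB : ∀ F, MeasurableSet F → B.toFun F = A.toFun (T ⁻¹' F)) (h : A.WeakFuzzier B) :
    ∃ Pc : Set Ω → Ω' → ℝ, (∀ E, Measurable (Pc E)) ∧ (∀ E t, 0 ≤ Pc E t) ∧
      ∀ (ρ : QState b) (μ : Measure Ω) [IsFiniteMeasure μ],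
        (∀ E, MeasurableSet E → μ.real E = trOp b (ρ.op ∘L A.toFun E)) →
        ∀ E, MeasurableSet E → ∀ F, MeasurableSet F →
          μ.real (E ∩ T ⁻¹' F) = ∫ t in F, Pc E t ∂(μ.map T) := by
  obtain ⟨κ, hκ, hAκ⟩ := h
  set m := A.refMeasure b with hm
  refine ⟨fun E t => (((m.restrict E).map T).rnDeriv (m.map T) t).toReal, fun E => by fun_prop,
    fun E t => ENNReal.toReal_nonneg, fun ρ μ _ hμ E hE F hF => ?_⟩
  have hac : μ ≪ m := by
    refine Measure.AbsolutelyContinuous.mk fun N hN hmN => ?_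
    obtain ⟨y, rfl⟩ := A.exists_eq_sum_measure ρ hμ
    rw [Measure.sum_apply _ hN, ENNReal.tsum_eq_zero]
    exact fun j => A.measure_eq_zero_of_toFun_eq_zero hN
      (A.toFun_eq_zero_of_refMeasure_eq_zero b hN hmN) (y j)
  have hdens : μ = m.withDensity fun ω => (μ.map T).rnDeriv (m.map T) (T ω) := by
    refine Measure.eq_withDensity_rnDeriv_map_comp hac hT fun E hE => ?_
    have hbd := (ae_comp_of_ae_map hT hB (hκ.bdd E hE)).ae_refMeasure b
    have hmeas : Measurable fun ω => κ E (T ω) := (hκ.meas E hE).comp hT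
    refine ⟨κ E, hκ.meas E hE, hbd, ?_, ?_⟩
    · rw [integral_eq_lintegral_of_nonneg_ae (hbd.mono fun ω hω => hω.1)
        hmeas.aestronglyMeasurable, measureReal_def]
      congr 1
      rw [hm, refMeasure, Measure.sum_apply _ hE, lintegral_sum_measure]
      refine tsum_congr fun i => ?_
      rw [lintegral_smul_measure, Measure.smul_apply,
        measure_eq_lintegral_of_kernel hT hB hκ hAκ hE]
    · rw [integral_eq_lintegral_of_nonneg_ae (hac.ae_le (hbd.mono fun ω hω => hω.1))
        hmeas.aestronglyMeasurable, measureReal_def]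
      congr 1
      obtain ⟨y, hy⟩ := A.exists_eq_sum_measure ρ hμ
      rw [hy, Measure.sum_apply _ hE, lintegral_sum_measure]
      exact tsum_congr fun i => measure_eq_lintegral_of_kernel hT hB hκ hAκ hE (y i)
  have hfin : ∀ᵐ t ∂(μ.map T), ((m.restrict E).map T).rnDeriv (m.map T) t < ∞ :=
    (hac.map hT).ae_le (Measure.rnDeriv_lt_top _ _)
  rw [integral_toReal (by fun_prop) (ae_restrict_of_ae hfin), measureReal_def]
  congr 1
  have key := Measure.setLIntegral_rnDeriv_map_restrict_of_withDensity_comp (μ := m) hT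
    (Measure.measurable_rnDeriv (μ.map T) (m.map T)) hE hF
  rw [← hdens] at key
  exact key.symm

/-- A conditional probability given `T` for all the scalar measures of `A` is a weak Markov kernel
recovering `A` from its image under `T`. -/
theorem weakFuzzier_of_conditional_probability (b : HilbertBasis ℕ ℂ H) {A : POVM Ω H}
    {B : POVM Ω' H} {T : Ω → Ω'} (hT : Measurable T)
    (hB : ∀ F, MeasurableSet F → B.toFun F = A.toFun (T ⁻¹' F)) {q : Set Ω → Ω' → ℝ}
    (hq : ∀ E, MeasurableSet E → Measurable (q E)) (hq0 : ∀ E t, MeasurableSet E → 0 ≤ q E t)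
    (hqA : ∀ x : H, ‖x‖ = 1 → ∀ E, MeasurableSet E → ∀ F, MeasurableSet F →
      (A.measure x).real (E ∩ T ⁻¹' F) = ∫ t in F, q E t ∂((A.measure x).map T)) :
    A.WeakFuzzier B := by
  have hb (i : ℕ) : ‖b i‖ = 1 := b.orthonormal.norm_eq_one i
  have hlint (i : ℕ) {E : Set Ω} (hE : MeasurableSet E) {F : Set Ω'} (hF : MeasurableSet F) :
      ∫⁻ t in F, ENNReal.ofReal (q E t) ∂((A.measure (b i)).map T)
        = A.measure (b i) (E ∩ T ⁻¹' F) :=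
    setLIntegral_ofReal_of_setIntegral_eq hT (hq E hE) (hq0 E · hE) (hqA _ (hb i) E hE) hF
  refine ⟨q, ⟨hq, fun E hE => ?_, ?_, ?_, fun E hE hdisj => ?_⟩, fun E hE x => ?_⟩
  · refine ae_of_forall_ae_measure b fun i => ?_
    rw [← map_measure hT hB]
    filter_upwards [ae_le_one_of_setIntegral_eq hT (hq E hE) (hq0 E · hE) (hqA _ (hb i) E hE)]
      with t ht using ⟨hq0 E t hE, ht⟩
  · refine ae_of_forall_ae_measure b fun i => ?_
    rw [← map_measure hT hB]
    filter_upwards [ae_eq_of_forall_setLIntegral_eq_of_sigmaFinite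
      (hq _ .univ).ennreal_ofReal (measurable_const (a := (1 : ℝ≥0∞))) fun F hF _ => by
        rw [hlint i .univ hF, Set.univ_inter, setLIntegral_one, Measure.map_apply hT hF]]
      with t ht using ENNReal.ofReal_eq_one.1 ht
  · refine ae_of_forall_ae_measure b fun i => ?_
    rw [← map_measure hT hB]
    filter_upwards [ae_eq_of_forall_setLIntegral_eq_of_sigmaFinite
      (hq _ .empty).ennreal_ofReal (measurable_const (a := (0 : ℝ≥0∞))) fun F hF _ => by
        rw [hlint i .empty hF]; simp]
      with t ht using le_antisymm (ENNReal.ofReal_eq_zero.1 ht) (hq0 ∅ t .empty)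
  · refine ae_of_forall_ae_measure b fun i => ?_
    rw [← map_measure hT hB]
    filter_upwards [ae_eq_of_forall_setLIntegral_eq_of_sigmaFinite
      (Measurable.tsum fun n => (hq _ (hE n)).ennreal_ofReal)
      (hq _ (.iUnion hE)).ennreal_ofReal fun F hF _ => by
        rw [lintegral_tsum fun n => (hq _ (hE n)).ennreal_ofReal.aemeasurable,
          hlint i (.iUnion hE) hF, Set.iUnion_inter, measure_iUnion
            (hdisj.mono fun _ _ h => h.mono Set.inter_subset_left Set.inter_subset_left)
            fun n => (hE n).inter (hT hF)]
        exact tsum_congr fun n => hlint i (hE n) hF] with t ht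
    have hsum := ENNReal.hasSum_toReal (ht.trans_ne ENNReal.ofReal_ne_top)
    rw [← ENNReal.tsum_toReal_eq fun _ => ENNReal.ofReal_ne_top, ht] at hsum
    simpa only [ENNReal.toReal_ofReal, hq0 _ t (hE _), hq0 _ t (.iUnion hE)] using hsum
  · rcases eq_or_ne x 0 with rfl | hx
    · have h0 : B.measure 0 = 0 := by simp [← Measure.measure_univ_eq_zero, B.measure_univ]
      simp [h0]
    · have hu : ‖((‖x‖⁻¹ : ℝ) : ℂ) • x‖ = 1 := by
        simp [norm_smul, norm_ne_zero_iff.2 hx]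
      have h := hqA _ hu E hE _ .univ
      rw [Set.preimage_univ, Set.inter_univ, map_measure hT hB, Measure.restrict_univ,
        A.measure_smul, B.measure_smul, measureReal_ennreal_smul_apply, integral_smul_measure,
        smul_eq_mul, A.measureReal_apply x hE] at h
      refine mul_left_cancel₀ ?_ h
      rw [ENNReal.toReal_ofReal (sq_nonneg _)]
      exact pow_ne_zero 2 (inv_ne_zero (norm_ne_zero_iff.2 hx))

end POVM

/-- A statistic `T` is sufficient for the statistical model
`{P^A_ρ}` (there is a conditional probability `P(E|t)` independent of the state `ρ`)
if and only if `A ≃_w A_T`, where `A_T` is the pushforward POVM. -/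
theorem stmt10 {ΩA ΩT : Type*} [MeasurableSpace ΩA] [MeasurableSpace ΩT]
    (b : HilbertBasis ℕ ℂ H) (A : POVM ΩA H)
    (T : ΩA → ΩT) (hT : Measurable T)
    (AT : POVM ΩT H) (hAT : ∀ F, MeasurableSet F → AT.toFun F = A.toFun (T ⁻¹' F))
    (P : QState b → Measure ΩA)
    (hP : ∀ (ρ : QState b) E, MeasurableSet E → (P ρ E).toReal = trOp b (ρ.op ∘L A.toFun E))
    (hPp : ∀ ρ, IsProbabilityMeasure (P ρ)) :
    (∃ Pc : Set ΩA → ΩT → ℝ, (∀ E, MeasurableSet E → Measurable (Pc E)) ∧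
        (∀ E t, MeasurableSet E → 0 ≤ Pc E t) ∧
        ∀ (ρ : QState b) (E : Set ΩA), MeasurableSet E → ∀ F, MeasurableSet F →
          ((P ρ) (E ∩ T ⁻¹' F)).toReal = ∫ t in F, Pc E t ∂((P ρ).map T))
      ↔ A.WeakEquiv AT := by
  refine ⟨fun ⟨Pc, hPc, hPc0, hcond⟩ => ⟨?_, POVM.weakFuzzier_of_map hT hAT⟩, fun h => ?_⟩
  · refine POVM.weakFuzzier_of_conditional_probability b hT hAT hPc hPc0 fun x hx E hE F hF => ?_
    have := A.eq_measure_of_pure hx (hP (QState.pure b x hx))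
    rw [← this]
    exact hcond _ E hE F hF
  · obtain ⟨Pc, hPc, hPc0, hcond⟩ := h.1.exists_conditional_probability (b := b) hT hAT
    exact ⟨Pc, fun E _ => hPc E, fun E t _ => hPc0 E t, fun ρ => hcond ρ (P ρ) (hP ρ)⟩
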